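/- arXiv:2103.13327 — 3 statements merged into one kernel-verified Lean document; each statement's English description precedes it below -/
import Mathlib

section
/- Let α ∈ ℝ, let Ỹ ∈ ℝ^{n×p} satisfy ỸᵀỸ = I_p, let Q ∈ ℝ^{n×k} satisfy QᵀQ = I_k and ỸᵀQ = 0, let A ∈ ℝ^{p×p} be antisymmetric and R ∈ ℝ^{k×p}, and set η := Ỹ·A + Q·R. Define [M(t); N(t)] := exp( t·[[2αA, −Rᵀ],[R, 0]] ) · [I_p; 0_{k×p}] (so M(t) ∈ ℝ^{p×p}, N(t) ∈ ℝ^{k×p}) and Y(t) := (Ỹ·M(t) + Q·N(t))·exp((1−2α)tA). Then Y(0) = Ỹ, Y'(0) = η, Y(t)ᵀY(t) = I_p for all t ∈ ℝ, and Y satisfies the α-geodesic equation. -/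
open Matrix NormedSpace
attribute [local instance] Matrix.normedAddCommGroup Matrix.normedSpace

/-- A twice-differentiable curve `Y : ℝ → ℝ^{n×p}` satisfies the α-geodesic equation if
`Y'' + Y (Y'ᵀ Y') + 2(1−α)(I − Y Yᵀ)(Y' Y'ᵀ) Y = 0`. -/
def IsAlphaGeodesic {n p : ℕ} (α : ℝ) (Y : ℝ → Matrix (Fin n) (Fin p) ℝ) : Prop :=
  (∀ t, DifferentiableAt ℝ Y t) ∧ (∀ t, DifferentiableAt ℝ (deriv Y) t) ∧
  ∀ t : ℝ, deriv (deriv Y) t + Y t * ((deriv Y t)ᵀ * deriv Y t)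
    + (2 * (1 - α)) • (((1 : Matrix (Fin n) (Fin n) ℝ) - Y t * (Y t)ᵀ)
        * (deriv Y t * (deriv Y t)ᵀ) * Y t) = 0

/-- Product rule for matrix-valued curves. -/
theorem hasDerivAt_matrix_mul {l m n : Type*} [Fintype l] [Fintype m] [Fintype n]
    {F : ℝ → Matrix l m ℝ} {G : ℝ → Matrix m n ℝ} {F' : Matrix l m ℝ} {G' : Matrix m n ℝ}
    {t : ℝ} (hF : HasDerivAt F F' t) (hG : HasDerivAt G G' t) :
    HasDerivAt (fun s => F s * G s) (F' * G t + F t * G') t := by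
  refine hasDerivAt_pi.2 fun i => hasDerivAt_pi.2 fun j => ?_
  have hF_entry (x : m) : HasDerivAt (fun s => F s i x) (F' i x) t :=
    hasDerivAt_pi.1 (hasDerivAt_pi.1 hF i) x
  have hG_entry (x : m) : HasDerivAt (fun s => G s x j) (G' x j) t :=
    hasDerivAt_pi.1 (hasDerivAt_pi.1 hG x) j
  have h := HasDerivAt.fun_sum (u := Finset.univ) fun x _ => (hF_entry x).fun_mul (hG_entry x)
  simpa [Matrix.mul_apply, Finset.sum_add_distrib] using h

theorem hasDerivAt_matrix_exp_smul {m : Type*} [Fintype m] [DecidableEq m]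
    (B : Matrix m m ℝ) (t : ℝ) :
    HasDerivAt (fun s : ℝ => exp (s • B)) (B * exp (t • B)) t := by
  let normedRing : NormedRing (Matrix m m ℝ) := Matrix.linftyOpNormedRing
  let : NormedAlgebra ℝ (Matrix m m ℝ) := Matrix.linftyOpNormedAlgebra
  have : @CompleteSpace (Matrix m m ℝ)
      normedRing.toSeminormedRing.toPseudoMetricSpace.toUniformSpace :=
    inferInstanceAs (CompleteSpace (m → m → ℝ))
  exact hasDerivAt_exp_smul_const' B t

/-- The transpose of the exponential of an antisymmetric matrix is a left inverse. -/
theorem transpose_exp_mul_exp {m : Type*} [Fintype m] [DecidableEq m]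
    {B : Matrix m m ℝ} (hB : Bᵀ = -B) : (exp B)ᵀ * exp B = 1 := by
  rw [← Matrix.exp_transpose, hB, ← Matrix.exp_add_of_commute _ _ (Commute.refl B).neg_left,
    neg_add_cancel, exp_zero]

theorem hasDerivAt_exp_mul_mul_exp {l m n : Type*} [Fintype l] [Fintype m] [DecidableEq m]
    [Fintype n] [DecidableEq n] (U : Matrix l m ℝ) (B : Matrix m m ℝ) (J : Matrix m n ℝ)
    (C : Matrix n n ℝ) (t : ℝ) :
    HasDerivAt (fun s : ℝ => U * exp (s • B) * J * exp (s • C))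
      (U * exp (t • B) * (B * J + J * C) * exp (t • C)) t := by
  have hE := hasDerivAt_matrix_mul (hasDerivAt_matrix_mul (hasDerivAt_const t U)
    (hasDerivAt_matrix_exp_smul B t)) (hasDerivAt_const t J)
  convert hasDerivAt_matrix_mul hE (hasDerivAt_matrix_exp_smul C t) using 1
  have hcomm : B * exp (t • B) = exp (t • B) * B :=
    (((Commute.refl B).smul_right t).exp_right).eq
  simp only [hcomm, Matrix.zero_mul, Matrix.mul_zero, zero_add, add_zero, Matrix.mul_add,
    Matrix.add_mul, Matrix.mul_assoc]

/-- Geodesic formula (14) of the paper: with `η = ỸA + QR`,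
`[M(t); N(t)] = exp(t[[2αA, −Rᵀ],[R,0]])[I;0]` and `Y(t) = (ỸM(t)+QN(t))exp((1−2α)tA)`,
`Y` is the geodesic with `Y(0)=Ỹ`, `Y'(0)=η` on the Stiefel manifold. -/
theorem stiefel_geodesic_formula_two {n p k : ℕ} (α : ℝ)
    (Ytilde : Matrix (Fin n) (Fin p) ℝ) (Q : Matrix (Fin n) (Fin k) ℝ)
    (A : Matrix (Fin p) (Fin p) ℝ) (R : Matrix (Fin k) (Fin p) ℝ)
    (hY : Ytildeᵀ * Ytilde = 1) (hQ : Qᵀ * Q = 1) (hYQ : Ytildeᵀ * Q = 0)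
    (hA : Aᵀ + A = 0) :
    let η : Matrix (Fin n) (Fin p) ℝ := Ytilde * A + Q * R
    let MN : ℝ → Matrix (Fin p ⊕ Fin k) (Fin p) ℝ := fun t =>
      exp (t • fromBlocks ((2 * α) • A) (-Rᵀ) R 0) *
        fromRows (1 : Matrix (Fin p) (Fin p) ℝ) (0 : Matrix (Fin k) (Fin p) ℝ)
    let M : ℝ → Matrix (Fin p) (Fin p) ℝ := fun t => (MN t).submatrix Sum.inl id
    let N : ℝ → Matrix (Fin k) (Fin p) ℝ := fun t => (MN t).submatrix Sum.inr id
    let Y : ℝ → Matrix (Fin n) (Fin p) ℝ := fun t =>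
      (Ytilde * M t + Q * N t) * exp (((1 - 2 * α) * t) • A)
    Y 0 = Ytilde ∧ deriv Y 0 = η ∧ (∀ t : ℝ, (Y t)ᵀ * Y t = 1) ∧ IsAlphaGeodesic α Y := by
  intro η MN M N Y
  have hA_neg : Aᵀ = -A := eq_neg_of_add_eq_zero_left hA
  set B : Matrix (Fin p ⊕ Fin k) (Fin p ⊕ Fin k) ℝ :=
    fromBlocks ((2 * α) • A) (-Rᵀ) R 0 with hB
  set J : Matrix (Fin p ⊕ Fin k) (Fin p) ℝ := fromRows 1 0 with hJ
  set C : Matrix (Fin p) (Fin p) ℝ := (1 - 2 * α) • A with hC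
  set U : Matrix (Fin n) (Fin p ⊕ Fin k) ℝ := fromCols Ytilde Q with hU
  set Z : Matrix (Fin p ⊕ Fin k) (Fin p) ℝ := fromRows A R with hZ
  have hYeq : Y = fun t : ℝ => U * exp (t • B) * J * exp (t • C) := by
    funext t
    have hrows : MN t = fromRows (M t) (N t) := by
      ext (i | i) j <;> rfl
    have hMN : exp (t • B) * J = fromRows (M t) (N t) := hrows
    rw [Matrix.mul_assoc U, hMN, hU, fromCols_mul_fromRows, hC, smul_smul, mul_comm t]
  have hB_neg : Bᵀ = -B := by
    simp [hB, fromBlocks_transpose, fromBlocks_neg, hA_neg]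
  have hC_neg : Cᵀ = -C := by simp [hC, hA_neg]
  have hUU : Uᵀ * U = 1 := by
    have hQY : Qᵀ * Ytilde = 0 := by simpa using congrArg Matrix.transpose hYQ
    rw [hU, transpose_fromCols, fromRows_mul_fromCols, hY, hQ, hYQ, hQY, fromBlocks_one]
  have hJJ : Jᵀ * J = 1 := by
    simp [hJ, transpose_fromRows, fromCols_mul_fromRows]
  have hBJ : B * J + J * C = Z := by
    ext (i | i) j
    · simp [hB, hJ, hC, hZ, fromBlocks_mul_fromRows, fromRows_mul]; ring
    · simp [hB, hJ, hC, hZ, fromBlocks_mul_fromRows, fromRows_mul]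
  have hYderiv (t : ℝ) : HasDerivAt Y (U * exp (t • B) * Z * exp (t • C)) t := by
    rw [hYeq, ← hBJ]
    exact hasDerivAt_exp_mul_mul_exp U B J C t
  have hderiv : deriv Y = fun t : ℝ => U * exp (t • B) * Z * exp (t • C) :=
    funext fun t => (hYderiv t).deriv
  have hYderiv_two (t : ℝ) :
      HasDerivAt (deriv Y) (U * exp (t • B) * (B * Z + Z * C) * exp (t • C)) t := by
    rw [hderiv]
    exact hasDerivAt_exp_mul_mul_exp U B Z C t
  have hVV (t : ℝ) : (U * exp (t • B))ᵀ * (U * exp (t • B)) = 1 := by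
    rw [transpose_mul, Matrix.mul_assoc, ← Matrix.mul_assoc Uᵀ, hUU, Matrix.one_mul,
      transpose_exp_mul_exp (by rw [transpose_smul, hB_neg, smul_neg])]
  have hFF (t : ℝ) : (exp (t • C))ᵀ * exp (t • C) = 1 :=
    transpose_exp_mul_exp (by rw [transpose_smul, hC_neg, smul_neg])
  have hZ_identity :
      B * Z + Z * C + J * (Zᵀ * Z) + (2 * (1 - α)) • ((1 - J * Jᵀ) * (Z * Zᵀ) * J) = 0 := by
    have hZJ : Zᵀ * J = -A := by
      simp [hZ, hJ, transpose_fromRows, fromCols_mul_fromRows, hA_neg]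
    have hJZ : Jᵀ * Z = A := by
      simp [hZ, hJ, transpose_fromRows, fromCols_mul_fromRows]
    have hexpand : (1 - J * Jᵀ) * (Z * Zᵀ) * J = (Z - J * A) * -A := by
      rw [Matrix.mul_assoc, Matrix.mul_assoc Z, hZJ, ← Matrix.mul_assoc, Matrix.sub_mul,
        Matrix.one_mul, Matrix.mul_assoc J, hJZ]
    rw [hexpand]
    ext (i | i) j
    · simp [hB, hJ, hC, hZ, fromBlocks_mul_fromRows, fromRows_mul, transpose_fromRows,
        fromCols_mul_fromRows, hA_neg, Matrix.sub_mul]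
      ring
    · simp [hB, hJ, hC, hZ, fromBlocks_mul_fromRows, fromRows_mul, transpose_fromRows,
        fromCols_mul_fromRows, hA_neg, Matrix.sub_mul]
      ring
  refine ⟨?_, ?_, fun t => ?_, fun t => (hYderiv t).differentiableAt,
    fun t => (hYderiv_two t).differentiableAt, fun t => ?_⟩
  · simp [hYeq, hU, hJ, fromCols_mul_fromRows]
  · simp [hderiv, hU, hZ, fromCols_mul_fromRows, η]
  · rw [hYeq]
    have hV := hVV t
    have hF := hFF t
    beta_reduce
    generalize U * exp (t • B) = V at *
    generalize exp (t • C) = F at *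
    rw [transpose_mul, transpose_mul, Matrix.mul_assoc, Matrix.mul_assoc, Matrix.mul_assoc V,
      ← Matrix.mul_assoc Vᵀ, hV, Matrix.one_mul, ← Matrix.mul_assoc Jᵀ, hJJ, Matrix.one_mul, hF]
  · have hderiv_two : deriv (deriv Y) t = U * exp (t • B) * (B * Z + Z * C) * exp (t • C) :=
      (hYderiv_two t).deriv
    rw [hderiv_two, hderiv, hYeq]
    have hV := hVV t
    have hF : exp (t • C) * (exp (t • C))ᵀ = 1 := mul_eq_one_comm.1 (hFF t)
    beta_reduce
    generalize U * exp (t • B) = V at *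
    generalize exp (t • C) = F at *
    have hV_mul {q : ℕ} (X : Matrix (Fin p ⊕ Fin k) (Fin q) ℝ) : Vᵀ * (V * X) = X := by
      rw [← Matrix.mul_assoc, hV, Matrix.one_mul]
    have hF_mul {q : ℕ} (X : Matrix (Fin p) (Fin q) ℝ) : F * (Fᵀ * X) = X := by
      rw [← Matrix.mul_assoc, hF, Matrix.one_mul]
    have hfactor := congrArg (fun X => V * X * F) hZ_identity
    simpa only [transpose_mul, Matrix.mul_add, Matrix.add_mul, Matrix.mul_sub, Matrix.sub_mul,
      Matrix.one_mul, Matrix.mul_smul, Matrix.smul_mul, Matrix.mul_assoc, hV_mul, hF_mul,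
      Matrix.mul_zero, Matrix.zero_mul] using hfactor
end

section
/- Let α ∈ ℝ and let Y : ℝ → ℝ^{n×p} be a twice-differentiable curve with Y(t)ᵀY(t) = I_p for all t that satisfies the α-geodesic equation, and suppose Y(t)ᵀY'(t) = A for all t (a constant antisymmetric matrix). Then S(t) := Y'(t)ᵀY'(t) satisfies S'(t) = (2α−1)(A·S(t) − S(t)·A) for all t, and consequently S(t) = exp((2α−1)tA)·S(0)·exp((1−2α)tA). -/
open Matrix NormedSpace
attribute [local instance] Matrix.normedAddCommGroup Matrix.normedSpace

/-- A matrix-valued curve is differentiable exactly when its entries are. -/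
theorem Matrix.hasDerivAt_iff {m n : Type*} [Fintype m] [Fintype n]
    {M : ℝ → Matrix m n ℝ} {M' : Matrix m n ℝ} {t : ℝ} :
    HasDerivAt M M' t ↔ ∀ i j, HasDerivAt (fun s => M s i j) (M' i j) t :=
  (hasDerivAt_pi (φ := M) (φ' := M')).trans (forall_congr' fun _ => hasDerivAt_pi)

theorem HasDerivAt.matrix_transpose {m n : Type*} [Fintype m] [Fintype n]
    {M : ℝ → Matrix m n ℝ} {M' : Matrix m n ℝ} {t : ℝ} (hM : HasDerivAt M M' t) :
    HasDerivAt (fun s => (M s)ᵀ) M'ᵀ t :=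
  Matrix.hasDerivAt_iff.2 fun i j => Matrix.hasDerivAt_iff.1 hM j i

theorem HasDerivAt.matrix_mul {l m n : Type*} [Fintype l] [Fintype m] [Fintype n]
    {M : ℝ → Matrix l m ℝ} {N : ℝ → Matrix m n ℝ} {M' : Matrix l m ℝ} {N' : Matrix m n ℝ} {t : ℝ}
    (hM : HasDerivAt M M' t) (hN : HasDerivAt N N' t) :
    HasDerivAt (fun s => M s * N s) (M' * N t + M t * N') t := by
  refine Matrix.hasDerivAt_iff.2 fun i j => ?_
  simp only [Matrix.add_apply, Matrix.mul_apply, ← Finset.sum_add_distrib]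
  exact HasDerivAt.fun_sum fun k _ =>
    (Matrix.hasDerivAt_iff.1 hM i k).mul (Matrix.hasDerivAt_iff.1 hN k j)

theorem Matrix.hasDerivAt_exp_smul {m : Type*} [Fintype m] [DecidableEq m]
    (A : Matrix m m ℝ) (t : ℝ) :
    HasDerivAt (fun s : ℝ => exp (s • A)) (exp (t • A) * A) t := by
  have hcomplete : @CompleteSpace (Matrix m m ℝ)
      Matrix.linftyOpNormedRing.toUniformSpace :=
    inferInstanceAs (CompleteSpace (m → m → ℝ))
  exact @hasDerivAt_exp_smul_const ℝ (Matrix m m ℝ) _ Matrix.linftyOpNormedRing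
    Matrix.linftyOpNormedAlgebra hcomplete A t

theorem Matrix.exp_smul_mul_exp_neg_smul {m : Type*} [Fintype m] [DecidableEq m]
    (A : Matrix m m ℝ) (t : ℝ) : exp (t • A) * exp (t • -A) = 1 := by
  rw [← Matrix.exp_add_of_commute _ _ (((Commute.refl A).neg_right.smul_right t).smul_left t),
    smul_neg, add_neg_cancel, NormedSpace.exp_zero]

/-- The solution of the Lax equation `S' = B S - S B` with constant `B`. -/
theorem Matrix.eq_exp_mul_mul_exp_of_hasDerivAt {m : Type*} [Fintype m] [DecidableEq m]
    {S : ℝ → Matrix m m ℝ} {B : Matrix m m ℝ}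
    (hS : ∀ t, HasDerivAt S (B * S t - S t * B) t) (t : ℝ) :
    S t = exp (t • B) * S 0 * exp (t • -B) := by
  have hD : ∀ t, HasDerivAt (fun s => exp (s • -B) * S s * exp (s • B)) 0 t := by
    intro t
    have hcomm : B * exp (t • B) = exp (t • B) * B :=
      (((Commute.refl B).smul_right t).exp_right).eq
    convert ((Matrix.hasDerivAt_exp_smul (-B) t).matrix_mul (hS t)).matrix_mul
      (Matrix.hasDerivAt_exp_smul B t) using 1
    rw [← hcomm]
    noncomm_ring
  have hconst := is_const_of_deriv_eq_zero (fun s => (hD s).differentiableAt)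
    (fun s => (hD s).deriv) t 0
  have hinv := Matrix.exp_smul_mul_exp_neg_smul B t
  have h0 : S 0 = exp (t • -B) * S t * exp (t • B) := by
    simpa [NormedSpace.exp_zero] using hconst.symm
  calc S t = (exp (t • B) * exp (t • -B)) * S t * (exp (t • B) * exp (t • -B)) := by
        rw [hinv, one_mul, mul_one]
    _ = exp (t • B) * S 0 * exp (t • -B) := by
        rw [h0]; simp only [Matrix.mul_assoc]

/-- The velocity Gram matrix of an α-geodesic satisfies a Lax equation. -/
theorem IsAlphaGeodesic.hasDerivAt_transpose_mul_self {n p : ℕ} {α : ℝ}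
    {Y : ℝ → Matrix (Fin n) (Fin p) ℝ} {A : Matrix (Fin p) (Fin p) ℝ}
    (hgeo : IsAlphaGeodesic α Y) (hA : Aᵀ + A = 0)
    (hconst : ∀ t : ℝ, (Y t)ᵀ * deriv Y t = A) (t : ℝ) :
    HasDerivAt (fun s => (deriv Y s)ᵀ * deriv Y s)
      ((2 * α - 1) • (A * ((deriv Y t)ᵀ * deriv Y t) - ((deriv Y t)ᵀ * deriv Y t) * A)) t := by
  obtain ⟨-, hdiff, heq⟩ := hgeo
  have hd := (hdiff t).hasDerivAt
  convert hd.matrix_transpose.matrix_mul hd using 1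
  have hAt : Aᵀ = -A := eq_neg_of_add_eq_zero_left hA
  have hYA := hconst t
  have hAY : (deriv Y t)ᵀ * Y t = -A := by
    rw [← hAt, ← hYA, transpose_mul, transpose_transpose]
  set Z := deriv Y t
  set S := Zᵀ * Z with hS
  have hSt : Sᵀ = S := by rw [hS, transpose_mul, transpose_transpose]
  have hacc : deriv (deriv Y) t =
      -(Y t * S) - (2 * (1 - α)) • ((1 - Y t * (Y t)ᵀ) * (Z * Zᵀ) * Y t) := by
    rw [eq_sub_iff_add_eq, eq_neg_iff_add_eq_zero, ← heq t]
    abel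
  have hproj : Zᵀ * ((1 - Y t * (Y t)ᵀ) * (Z * Zᵀ) * Y t) = -((S + A * A) * A) := by
    calc _ = (Zᵀ * Z - (Zᵀ * Y t) * ((Y t)ᵀ * Z)) * (Zᵀ * Y t) := by
          simp only [Matrix.sub_mul, Matrix.mul_sub, Matrix.mul_assoc, Matrix.one_mul]
      _ = _ := by rw [hAY, hYA, ← hS]; noncomm_ring
  have hZ : Zᵀ * deriv (deriv Y) t = A * S + (2 * (1 - α)) • ((S + A * A) * A) := by
    rw [hacc, Matrix.mul_sub, Matrix.mul_neg, ← Matrix.mul_assoc, hAY, Matrix.mul_smul, hproj,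
      Matrix.neg_mul, neg_neg, smul_neg, sub_neg_eq_add]
  have hZt : (deriv (deriv Y) t)ᵀ * Z = -(S * A) - (2 * (1 - α)) • (A * (S + A * A)) := by
    rw [← transpose_transpose Z, ← transpose_mul, hZ]
    simp only [transpose_add, transpose_mul, transpose_smul, hAt, hSt]
    simp only [Matrix.mul_neg, Matrix.neg_mul, neg_neg, smul_neg, sub_eq_add_neg]
  have hsum : (2 * α - 1) • (A * S - S * A) =
      (deriv (deriv Y) t)ᵀ * Z + Zᵀ * deriv (deriv Y) t := by
    rw [hZ, hZt]
    simp only [Matrix.mul_add, Matrix.add_mul, Matrix.mul_assoc]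
    module
  exact hsum

/-- Along an α-geodesic with `Y(t)ᵀ Y'(t) = A` constant antisymmetric, `S(t) = Y'(t)ᵀ Y'(t)`
satisfies the Lax-type equation `S' = (2α−1)(AS − SA)`, hence
`S(t) = exp((2α−1)tA) S(0) exp((1−2α)tA)`. -/
theorem stiefel_geodesic_S_evolution {n p : ℕ} (α : ℝ)
    (Y : ℝ → Matrix (Fin n) (Fin p) ℝ) (A : Matrix (Fin p) (Fin p) ℝ)
    (hSt : ∀ t : ℝ, (Y t)ᵀ * Y t = 1)
    (hgeo : IsAlphaGeodesic α Y)
    (hA : Aᵀ + A = 0)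
    (hconst : ∀ t : ℝ, (Y t)ᵀ * deriv Y t = A) :
    (∀ t : ℝ, deriv (fun s => (deriv Y s)ᵀ * deriv Y s) t
      = (2 * α - 1) • (A * ((deriv Y t)ᵀ * deriv Y t) - ((deriv Y t)ᵀ * deriv Y t) * A)) ∧
    (∀ t : ℝ, (deriv Y t)ᵀ * deriv Y t
      = exp (((2 * α - 1) * t) • A) * ((deriv Y 0)ᵀ * deriv Y 0)
        * exp (((1 - 2 * α) * t) • A)) := by
  have hS := hgeo.hasDerivAt_transpose_mul_self hA hconst
  refine ⟨fun t => (hS t).deriv, fun t => ?_⟩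
  have hsol := Matrix.eq_exp_mul_mul_exp_of_hasDerivAt (B := (2 * α - 1) • A)
    (S := fun s => (deriv Y s)ᵀ * deriv Y s)
    (fun s => by simpa only [smul_sub, Matrix.smul_mul, Matrix.mul_smul] using hS s) t
  convert hsol using 3
  · rw [smul_smul, mul_comm t]
  · rw [← neg_smul, smul_smul]
    congr 1
    ring
end

section
/- Let α ∈ ℝ, let Ỹ ∈ ℝ^{n×m} and Q ∈ ℝ^{n×k} satisfy ỸᵀỸ = I_m, QᵀQ = I_k, ỸᵀQ = 0, let Z ∈ ℝ^{n×m} satisfy ZᵀZ = I_m, and let Λ ∈ ℝ^{m×m} be diagonal. Set K := [Ỹ Q], H := Kᵀ·Z·Λ·Zᵀ·K, P := [I_m; 0_{k×m}]. For an antisymmetric A ∈ ℝ^{m×m} and R ∈ ℝ^{k×m}, set Â := [[2αA, −Rᵀ],[R, 0]], G := exp((1−2α)A)·Λ·exp((1−2α)A)ᵀ, and F_Fg(A,R) := −Tr( H·exp(Â)·P·G·Pᵀ·exp(Â)ᵀ ). Let [U₁₁; U₂₁] := exp(Â)·P (so U₁₁ ∈ ℝ^{m×m}, U₂₁ ∈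 ℝ^{k×m}). Fix an antisymmetric ΔA ∈ ℝ^{m×m} and ΔR ∈ ℝ^{k×m}, and set ΔÂ := [[2αΔA, −ΔRᵀ],[ΔR, 0]], L̂ := L_exp(Â, 2·P·G·Pᵀ·exp(Â)ᵀ·H), and L̊ := L_exp((1−2α)A, 2·Λ·exp((1−2α)A)ᵀ·(U₁₁ᵀ·H·U₁₁ + U₂₁ᵀ·H·U₂₁)). Then the function s ↦ F_Fg(A + sΔA, R + sΔR) is differentiable at s = 0 with derivative equal to −Tr(L̂·ΔÂ) − (1−2α)·Tr(L̊·ΔA). -/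
open Matrix NormedSpace

/-- The Fréchet derivative of the matrix exponential:
`L_exp(A, E) = ∑_{i≥1} (1/i!) ∑_{a+b=i−1} A^a E A^b`. -/
noncomputable def Lexp {ι : Type*} [Fintype ι] [DecidableEq ι]
    (A E : Matrix ι ι ℝ) : Matrix ι ι ℝ :=
  ∑' i : ℕ, ((Nat.factorial (i + 1) : ℝ))⁻¹ •
    ∑ a ∈ Finset.range (i + 1), A ^ a * E * A ^ (i - a)

section BanachAlgebra

variable {𝔸 : Type*} [NormedRing 𝔸]

theorem norm_pow_le_norm_one_mul_pow {x : 𝔸} {M : ℝ} (hx : ‖x‖ ≤ M) (i : ℕ) :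
    ‖x ^ i‖ ≤ ‖(1 : 𝔸)‖ * M ^ i := by
  induction i with
  | zero => simp
  | succ i ih =>
    calc ‖x ^ (i + 1)‖ ≤ ‖x ^ i‖ * ‖x‖ := by rw [pow_succ]; exact norm_mul_le _ _
      _ ≤ ‖(1 : 𝔸)‖ * M ^ i * M := by gcongr; exact (norm_nonneg _).trans ih
      _ = ‖(1 : 𝔸)‖ * M ^ (i + 1) := by ring

variable [NormedAlgebra ℝ 𝔸]

/-- Bound on the terms of the series for the Fréchet derivative of the exponential. -/
theorem norm_expDeriv_term_le {x : 𝔸} {M : ℝ} (hx : ‖x‖ ≤ M) (e : 𝔸) (i : ℕ) :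
    ‖((Nat.factorial (i + 1) : ℝ))⁻¹ • ∑ a ∈ Finset.range (i + 1), x ^ a * e * x ^ (i - a)‖ ≤
      ‖(1 : 𝔸)‖ ^ 2 * ‖e‖ * (M ^ i / Nat.factorial i) := by
  have hM : 0 ≤ M := (norm_nonneg x).trans hx
  have hterm : ∀ a ∈ Finset.range (i + 1),
      ‖x ^ a * e * x ^ (i - a)‖ ≤ ‖(1 : 𝔸)‖ ^ 2 * ‖e‖ * M ^ i := by
    intro a ha
    have hai : a + (i - a) = i := by grind
    calc ‖x ^ a * e * x ^ (i - a)‖ ≤ ‖x ^ a‖ * ‖e‖ * ‖x ^ (i - a)‖ := norm_mul₃_le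
      _ ≤ (‖(1 : 𝔸)‖ * M ^ a) * ‖e‖ * (‖(1 : 𝔸)‖ * M ^ (i - a)) := by
        gcongr <;> exact norm_pow_le_norm_one_mul_pow hx _
      _ = ‖(1 : 𝔸)‖ ^ 2 * ‖e‖ * M ^ (a + (i - a)) := by ring
      _ = ‖(1 : 𝔸)‖ ^ 2 * ‖e‖ * M ^ i := by rw [hai]
  have hsum := norm_sum_le_of_le _ hterm
  rw [Finset.sum_const, Finset.card_range, nsmul_eq_mul] at hsum
  rw [norm_smul, norm_inv, RCLike.norm_natCast]
  calc ((Nat.factorial (i + 1) : ℝ))⁻¹ *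
        ‖∑ a ∈ Finset.range (i + 1), x ^ a * e * x ^ (i - a)‖
      ≤ ((Nat.factorial (i + 1) : ℝ))⁻¹ *
        (((i + 1 : ℕ) : ℝ) * (‖(1 : 𝔸)‖ ^ 2 * ‖e‖ * M ^ i)) := by gcongr
    _ = ‖(1 : 𝔸)‖ ^ 2 * ‖e‖ * (M ^ i / Nat.factorial i) := by
      rw [Nat.factorial_succ]
      push_cast
      field_simp

theorem summable_expDeriv_bound (C M : ℝ) :
    Summable fun i : ℕ => C * (M ^ i / Nat.factorial i) :=
  (Real.summable_pow_div_factorial M).mul_left C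

variable [CompleteSpace 𝔸]

theorem summable_expDeriv (x e : 𝔸) :
    Summable fun i : ℕ => ((Nat.factorial (i + 1) : ℝ))⁻¹ •
      ∑ a ∈ Finset.range (i + 1), x ^ a * e * x ^ (i - a) :=
  .of_norm_bounded (summable_expDeriv_bound _ _) (norm_expDeriv_term_le le_rfl e)

theorem hasDerivAt_exp_add_smul [Algebra ℚ 𝔸] (x e : 𝔸) :
    HasDerivAt (fun s : ℝ => exp (x + s • e))
      (∑' i : ℕ, ((Nat.factorial (i + 1) : ℝ))⁻¹ •
        ∑ a ∈ Finset.range (i + 1), x ^ a * e * x ^ (i - a)) 0 := by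
  have hline : ∀ s : ℝ, HasDerivAt (fun s : ℝ => x + s • e) e s := fun s => by
    simpa using ((hasDerivAt_id s).smul_const e).const_add x
  have hexp : ∀ y : 𝔸, exp y = 1 + ∑' i : ℕ, ((Nat.factorial (i + 1) : ℝ))⁻¹ • y ^ (i + 1) := by
    intro y
    simp only [exp_eq_tsum ℝ]
    rw [(expSeries_summable' (𝕂 := ℝ) y).tsum_eq_zero_add]
    simp
  simp_rw [hexp]
  refine HasDerivAt.const_add _ ?_
  have key := hasDerivAt_tsum_of_isPreconnected (y₀ := (0 : ℝ)) (y := (0 : ℝ))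
    (g := fun (i : ℕ) (s : ℝ) => ((Nat.factorial (i + 1) : ℝ))⁻¹ • (x + s • e) ^ (i + 1))
    (g' := fun (i : ℕ) (s : ℝ) => ((Nat.factorial (i + 1) : ℝ))⁻¹ •
      ∑ a ∈ Finset.range (i + 1), (x + s • e) ^ a * e * (x + s • e) ^ (i - a))
    (summable_expDeriv_bound (‖(1 : 𝔸)‖ ^ 2 * ‖e‖) (‖x‖ + ‖e‖))
    (Metric.isOpen_ball (x := 0) (ε := 1))
    (convex_ball (0 : ℝ) 1).isPreconnected ?_ ?_ (by simp) ?_ (by simp)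
  · simpa using key
  · intro i s _
    refine HasDerivAt.fun_const_smul _ (((hline s).fun_pow' (i + 1)).congr_deriv ?_)
    rw [← Finset.sum_range_reflect]
    refine Finset.sum_congr rfl fun a ha => ?_
    have ha' : a ≤ i := by grind
    simp [Nat.sub_sub_self ha']
  · intro i s hs
    refine norm_expDeriv_term_le ((norm_add_le _ _).trans ?_) e i
    have hs' : ‖s‖ ≤ 1 := by simpa using (mem_ball_zero_iff.mp hs).le
    rw [norm_smul]
    gcongr
    exact mul_le_of_le_one_left (norm_nonneg e) hs'
  · exact (summable_nat_add_iff 1).mpr (expSeries_summable' (𝕂 := ℝ) (x + (0 : ℝ) • e))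

end BanachAlgebra

section MatrixCalculus

variable {l m n ι : Type*} [Fintype m] [Fintype ι]

open scoped Matrix.Norms.Operator in
theorem hasSum_Lexp [DecidableEq ι] (A E : Matrix ι ι ℝ) :
    HasSum (fun i : ℕ => ((Nat.factorial (i + 1) : ℝ))⁻¹ •
      ∑ a ∈ Finset.range (i + 1), A ^ a * E * A ^ (i - a)) (Lexp A E) :=
  (summable_expDeriv A E).hasSum

open scoped Matrix.Norms.Operator in
theorem hasDerivAt_exp_add_smul_apply [DecidableEq ι] (A E : Matrix ι ι ℝ) (i j : ι) :
    HasDerivAt (fun s : ℝ => exp (A + s • E) i j) (Lexp A E i j) 0 :=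
  (LinearMap.toContinuousLinearMap
    (Matrix.entryLinearMap ℝ ℝ i j)).hasFDerivAt.comp_hasDerivAt (0 : ℝ)
      (hasDerivAt_exp_add_smul A E)

/-- The operator `Lexp A` is self-adjoint for the trace pairing. -/
theorem trace_mul_Lexp [DecidableEq ι] (A E D : Matrix ι ι ℝ) :
    trace (E * Lexp A D) = trace (Lexp A E * D) := by
  have hleft := ((hasSum_Lexp A D).mul_left E).map (traceAddMonoidHom ι ℝ)
    (Continuous.matrix_trace continuous_id)
  have hright := ((hasSum_Lexp A E).mul_right D).map (traceAddMonoidHom ι ℝ)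
    (Continuous.matrix_trace continuous_id)
  refine hleft.unique ?_
  convert! hright using 1
  funext i
  simp only [Function.comp_apply, traceAddMonoidHom_apply, Matrix.mul_smul, Matrix.smul_mul,
    trace_smul, Finset.mul_sum, Finset.sum_mul, trace_sum]
  congr 1
  rw [← Finset.sum_range_reflect]
  refine Finset.sum_congr rfl fun a ha => ?_
  have ha' : a ≤ i := by grind
  simp only [Nat.add_sub_cancel, Nat.sub_sub_self ha']
  rw [← Matrix.mul_assoc, trace_mul_comm]
  simp only [Matrix.mul_assoc]

theorem hasDerivAt_matrix_mul_apply {M : ℝ → Matrix l m ℝ} {N : ℝ → Matrix m n ℝ}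
    {M' : Matrix l m ℝ} {N' : Matrix m n ℝ} {x : ℝ}
    (hM : ∀ i j, HasDerivAt (fun s => M s i j) (M' i j) x)
    (hN : ∀ i j, HasDerivAt (fun s => N s i j) (N' i j) x) (i : l) (j : n) :
    HasDerivAt (fun s => (M s * N s) i j) ((M' * N x + M x * N') i j) x := by
  simp only [Matrix.mul_apply, Matrix.add_apply, ← Finset.sum_add_distrib]
  exact HasDerivAt.fun_sum fun a _ => (hM i a).mul (hN a j)

theorem hasDerivAt_const_matrix_apply (x : ℝ) (M : Matrix l n ℝ) (i : l) (j : n) :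
    HasDerivAt (fun _ : ℝ => M i j) ((0 : Matrix l n ℝ) i j) x :=
  hasDerivAt_const x (M i j)

theorem hasDerivAt_trace_conj {H : Matrix ι ι ℝ} {Λ : Matrix m m ℝ} (P : Matrix ι m ℝ)
    (hH : Hᵀ = H) (hΛ : Λᵀ = Λ) {X : ℝ → Matrix ι ι ℝ} {W : ℝ → Matrix m m ℝ}
    {X' : Matrix ι ι ℝ} {W' : Matrix m m ℝ} {x : ℝ}
    (hX : ∀ i j, HasDerivAt (fun s => X s i j) (X' i j) x)
    (hW : ∀ i j, HasDerivAt (fun s => W s i j) (W' i j) x) :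
    HasDerivAt (fun s => trace (H * X s * P * (W s * Λ * (W s)ᵀ) * Pᵀ * (X s)ᵀ))
      (2 * trace (P * (W x * Λ * (W x)ᵀ) * Pᵀ * (X x)ᵀ * H * X') +
        2 * trace (Λ * (W x)ᵀ * ((X x * P)ᵀ * H * (X x * P)) * W')) x := by
  have hG := hasDerivAt_matrix_mul_apply (N := fun s => (W s)ᵀ) (N' := W'ᵀ)
    (hasDerivAt_matrix_mul_apply (N := fun _ => Λ) hW (hasDerivAt_const_matrix_apply x Λ))
    fun i j => hW j i
  have hHXP := hasDerivAt_matrix_mul_apply (N := fun _ => P)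
    (hasDerivAt_matrix_mul_apply (M := fun _ => H) (hasDerivAt_const_matrix_apply x H) hX)
    (hasDerivAt_const_matrix_apply x P)
  have hprod := hasDerivAt_matrix_mul_apply (N := fun s => (X s)ᵀ) (N' := X'ᵀ)
    (hasDerivAt_matrix_mul_apply (N := fun _ => Pᵀ) (hasDerivAt_matrix_mul_apply hHXP hG)
      (hasDerivAt_const_matrix_apply x Pᵀ)) fun i j => hX j i
  have htrace := HasDerivAt.fun_sum (u := Finset.univ) fun i _ => hprod i i
  refine htrace.congr_deriv ?_
  change trace _ = _
  have hX₁ : trace (H * X' * P * (W x * Λ * (W x)ᵀ) * Pᵀ * (X x)ᵀ) =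
      trace (P * (W x * Λ * (W x)ᵀ) * Pᵀ * (X x)ᵀ * H * X') := by
    rw [trace_mul_comm (P * (W x * Λ * (W x)ᵀ) * Pᵀ * (X x)ᵀ * H) X', Matrix.mul_assoc H,
      Matrix.mul_assoc H, Matrix.mul_assoc H, Matrix.mul_assoc H, trace_mul_comm H]
    simp only [Matrix.mul_assoc]
  have hX₂ : trace (H * X x * P * (W x * Λ * (W x)ᵀ) * Pᵀ * X'ᵀ) =
      trace (P * (W x * Λ * (W x)ᵀ) * Pᵀ * (X x)ᵀ * H * X') := by
    rw [← trace_transpose, trace_mul_comm _ X']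
    simp only [Matrix.transpose_mul, Matrix.transpose_transpose, hH, hΛ, Matrix.mul_assoc]
  have hW₁ : trace (H * X x * P * (W' * Λ * (W x)ᵀ) * Pᵀ * (X x)ᵀ) =
      trace (Λ * (W x)ᵀ * ((X x * P)ᵀ * H * (X x * P)) * W') := by
    have hsplit : H * X x * P * (W' * Λ * (W x)ᵀ) * Pᵀ * (X x)ᵀ =
        (H * X x * P * W') * (Λ * (W x)ᵀ * Pᵀ * (X x)ᵀ) := by
      simp only [Matrix.mul_assoc]
    rw [hsplit, trace_mul_comm]
    simp only [Matrix.transpose_mul, Matrix.mul_assoc]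
  have hW₂ : trace (H * X x * P * (W x * Λ * W'ᵀ) * Pᵀ * (X x)ᵀ) =
      trace (Λ * (W x)ᵀ * ((X x * P)ᵀ * H * (X x * P)) * W') := by
    have hsplit : H * X x * P * (W x * Λ * W'ᵀ) * Pᵀ * (X x)ᵀ =
        (H * X x * P * W x * Λ) * (W'ᵀ * Pᵀ * (X x)ᵀ) := by
      simp only [Matrix.mul_assoc]
    rw [hsplit, ← trace_transpose, Matrix.transpose_mul, trace_mul_comm]
    simp only [Matrix.transpose_mul, Matrix.transpose_transpose, hH, hΛ, Matrix.mul_assoc]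
  simp only [Matrix.mul_zero, Matrix.zero_mul, add_zero, zero_add, Matrix.mul_add, Matrix.add_mul,
    trace_add, hX₁, hX₂, hW₁, hW₂]
  ring

end MatrixCalculus

/-- Gradient of the flag-manifold log objective
`F_Fg(A,R) = −Tr(H exp(Â) P G Pᵀ exp(Â)ᵀ)` with `K = [Ỹ Q]`, `H = KᵀZΛZᵀK`,
`G = exp((1−2α)A) Λ exp((1−2α)A)ᵀ`: the directional derivative at `(A,R)` along `(ΔA,ΔR)`
is `−Tr(L̂ ΔÂ) − (1−2α)Tr(L̊ ΔA)` with the indicated Fréchet derivatives.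
Here `U = [U₁₁; U₂₁] = exp(Â)P` and `U₁₁ᵀHU₁₁ + U₂₁ᵀHU₂₁` is the block expression
`[U₁₁ᵀ U₂₁ᵀ]·H·[U₁₁; U₂₁] = Uᵀ H U`. -/
theorem flag_objective_gradient {n m k : ℕ} (α : ℝ)
    (Ytilde Z : Matrix (Fin n) (Fin m) ℝ) (Q : Matrix (Fin n) (Fin k) ℝ)
    (hY : Ytildeᵀ * Ytilde = 1) (hQ : Qᵀ * Q = 1) (hYQ : Ytildeᵀ * Q = 0)
    (hZ : Zᵀ * Z = 1) (lam : Fin m → ℝ)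
    (A ΔA : Matrix (Fin m) (Fin m) ℝ) (R ΔR : Matrix (Fin k) (Fin m) ℝ)
    (hA : Aᵀ + A = 0) (hΔA : ΔAᵀ + ΔA = 0) :
    let Λ : Matrix (Fin m) (Fin m) ℝ := Matrix.diagonal lam
    let hat : Matrix (Fin m) (Fin m) ℝ → Matrix (Fin k) (Fin m) ℝ →
        Matrix (Fin m ⊕ Fin k) (Fin m ⊕ Fin k) ℝ :=
      fun B S => fromBlocks ((2 * α) • B) (-Sᵀ) S 0
    let P : Matrix (Fin m ⊕ Fin k) (Fin m) ℝ :=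
      fromRows (1 : Matrix (Fin m) (Fin m) ℝ) (0 : Matrix (Fin k) (Fin m) ℝ)
    let K : Matrix (Fin n) (Fin m ⊕ Fin k) ℝ := fromCols Ytilde Q
    let H : Matrix (Fin m ⊕ Fin k) (Fin m ⊕ Fin k) ℝ := Kᵀ * Z * Λ * Zᵀ * K
    let G : Matrix (Fin m) (Fin m) ℝ → Matrix (Fin m) (Fin m) ℝ :=
      fun B => exp ((1 - 2 * α) • B) * Λ * (exp ((1 - 2 * α) • B))ᵀ
    let FFg : Matrix (Fin m) (Fin m) ℝ → Matrix (Fin k) (Fin m) ℝ → ℝ :=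
      fun B S => -Matrix.trace (H * exp (hat B S) * P * G B * Pᵀ * (exp (hat B S))ᵀ)
    let U : Matrix (Fin m ⊕ Fin k) (Fin m) ℝ := exp (hat A R) * P
    let Lhat : Matrix (Fin m ⊕ Fin k) (Fin m ⊕ Fin k) ℝ :=
      Lexp (hat A R) ((2 : ℝ) • (P * G A * Pᵀ * (exp (hat A R))ᵀ * H))
    let Lring : Matrix (Fin m) (Fin m) ℝ :=
      Lexp ((1 - 2 * α) • A)
        ((2 : ℝ) • (Λ * (exp ((1 - 2 * α) • A))ᵀ * (Uᵀ * H * U)))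
    HasDerivAt (fun s : ℝ => FFg (A + s • ΔA) (R + s • ΔR))
      (-Matrix.trace (Lhat * hat ΔA ΔR) - (1 - 2 * α) * Matrix.trace (Lring * ΔA)) 0 := by
  intro Λ hat P K H G FFg U Lhat Lring
  have hΛ : Λᵀ = Λ := diagonal_transpose lam
  have hH : Hᵀ = H := by simp [H, Matrix.transpose_mul, hΛ, Matrix.mul_assoc]
  have hhat : ∀ s : ℝ, hat (A + s • ΔA) (R + s • ΔR) = hat A R + s • hat ΔA ΔR := fun s => by
    simp [hat, fromBlocks_smul, fromBlocks_add, smul_comm s, add_comm]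
  set c : ℝ := 1 - 2 * α
  set X := exp (hat A R)
  set W := exp (c • A)
  set X' := Lexp (hat A R) (hat ΔA ΔR) with hX'
  set W' := Lexp (c • A) (c • ΔA) with hW'
  have hdX : ∀ i j, HasDerivAt (fun s : ℝ => exp (hat (A + s • ΔA) (R + s • ΔR)) i j)
      (X' i j) 0 := by
    simp_rw [hhat]
    exact hasDerivAt_exp_add_smul_apply _ _
  have hdW : ∀ i j, HasDerivAt (fun s : ℝ => exp (c • (A + s • ΔA)) i j) (W' i j) 0 := by
    simp_rw [smul_add, smul_comm c]
    exact hasDerivAt_exp_add_smul_apply _ _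
  have hF := (hasDerivAt_trace_conj P hH hΛ hdX hdW).neg
  refine hF.congr_deriv ?_
  simp only [zero_smul, add_zero, Lhat, Lring, hX', hW', ← trace_mul_Lexp, G, U]
  rw [trace_mul_Lexp (c • A) _ (c • ΔA), Matrix.mul_smul, trace_smul, ← trace_mul_Lexp]
  simp only [Matrix.smul_mul, trace_smul, smul_eq_mul]
  ring
end
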